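/- For every ε > 0 there exists N₀ such that for all N > N₀ and all family sizes F with 1 ≤ log₂ F < N/12, if a family 𝓕 is chosen uniformly at random among all subsets of {-1,1}^N of cardinality F, then with probability at least 1 - ε one has (2/5)·√(N·(log C(N,k) + k·log F)) < Φ_k(𝓕) < (5/2)·√(N·(log C(N,k) + k·log F)) simultaneously for every integer k with 2 ≤ k ≤ N/(6·log₂ F). Here C(N,k) denotes the binomial coefficient and log is the natural logarithm. -/

import Mathlib

/-- The value `±1` associated to a Boolean. -/
def pmVal (b : Bool) : ℤ := if b then 1 else -1

/-- Entry of a binary sequence `E ∈ {-1,1}^N` at (0-based) position `t`,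
defaulting to `1` out of range. -/
def seqAt {N : ℕ} (E : Fin N → Bool) (t : ℕ) : ℤ :=
  if h : t < N then pmVal (E ⟨t, h⟩) else 1

/-- Set of values `|V_k(E⁽¹⁾,…,E⁽ᵏ⁾,M,D)|` over all admissible parameters:
`E⁽¹⁾,…,E⁽ᵏ⁾ ∈ 𝓕`, `0 ≤ d₁ ≤ … ≤ d_k`, `1 ≤ M`, `M + d_k ≤ N`, and if
`E⁽ⁱ⁾ = E⁽ʲ⁾` for `i ≠ j` then `dᵢ ≠ dⱼ`. -/
def famCorrSet {N : ℕ} (k : ℕ) (F : Finset (Fin N → Bool)) : Set ℕ :=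
  {v | ∃ (E : Fin k → (Fin N → Bool)) (d : Fin k → ℕ) (M : ℕ),
      (∀ i, E i ∈ F) ∧ Monotone d ∧ 1 ≤ M ∧ (∀ i, M + d i ≤ N) ∧
      (∀ i j, i ≠ j → E i = E j → d i ≠ d j) ∧
      v = (∑ n ∈ Finset.range M, ∏ i, seqAt (E i) (n + d i)).natAbs}

/-- The cross-correlation measure `Φₖ(𝓕)` of order `k` of a family `𝓕 ⊆ {-1,1}^N`. -/
noncomputable def famCrossCorr {N : ℕ} (k : ℕ) (F : Finset (Fin N → Bool)) : ℕ :=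
  sSup (famCorrSet k F)

open scoped Finset

open Polynomial in
/-- The polynomial `∑ X ^ d` over the positions `d` that `S` uses in the `j`-th sequence. -/
noncomputable def positionPoly {F : ℕ} (S : Finset (ℕ × Fin F)) (j : Fin F) : (ZMod 2)[X] :=
  ∑ p ∈ S, if p.2 = j then X ^ p.1 else 0

/-- The correlation sum of the sequences `ω j` along the positions in `S`. -/
def corrSum {N F : ℕ} (ω : Fin F → Fin N → Bool) (S : Finset (ℕ × Fin F)) (M : ℕ) : ℤ :=
  ∑ n ∈ Finset.range M, ∏ p ∈ S, seqAt (ω p.2) (n + p.1)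

/-- The sign `±1` of a bit. -/
def bitSign (z : ZMod 2) : ℤ := if z = 0 then 1 else -1

/-- The linear form computing the exponent of the `n`-th term of `corrSum`. -/
def termForm {N F : ℕ} (S : Finset (ℕ × Fin F)) (n : ℕ) :
    (Fin F → Fin N → ZMod 2) →ₗ[ZMod 2] ZMod 2 :=
  ∑ p ∈ S, if h : n + p.1 < N then LinearMap.proj ⟨n + p.1, h⟩ ∘ₗ LinearMap.proj p.2 else 0

/-- The bits of a Boolean, with `true` corresponding to the sign `+1`. -/
def boolBit : Bool ≃ ZMod 2 where
  toFun b := if b then 0 else 1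
  invFun z := z = 0
  left_inv b := by cases b <;> decide
  right_inv z := by revert z; decide

lemma bitSign_boolBit (b : Bool) : bitSign (boolBit b) = pmVal b := by
  cases b <;> decide

lemma bitSign_sum {ι : Type*} (s : Finset ι) (z : ι → ZMod 2) :
    bitSign (∑ i ∈ s, z i) = ∏ i ∈ s, bitSign (z i) := by
  classical
  have hadd : ∀ a b : ZMod 2, bitSign (a + b) = bitSign a * bitSign b := by decide
  induction s using Finset.induction_on with
  | empty => simp [bitSign]
  | insert a s ha ih => rw [Finset.sum_insert ha, Finset.prod_insert ha, hadd, ih]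

lemma corrSum_eq_sum_bitSign {N F : ℕ} (ω : Fin F → Fin N → Bool) (S : Finset (ℕ × Fin F))
    (M : ℕ) :
    corrSum ω S M =
      ∑ n : Fin M, bitSign (termForm S n (fun j t => boolBit (ω j t))) := by
  rw [corrSum, Finset.sum_range]
  refine Finset.sum_congr rfl fun n _ => ?_
  rw [termForm, LinearMap.sum_apply, bitSign_sum]
  refine Finset.prod_congr rfl fun p _ => ?_
  unfold seqAt
  split_ifs with h
  · simp [bitSign_boolBit]
  · simp [bitSign]

lemma coeff_positionPoly_mul {N F M : ℕ} (S : Finset (ℕ × Fin F)) (c : Fin M → ZMod 2)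
    (j : Fin F) (t : Fin N) :
    ((∑ n : Fin M, Polynomial.monomial (n : ℕ) (c n)) * positionPoly S j).coeff t =
      ∑ n, c n * termForm S n (Pi.single j (Pi.single t 1)) := by
  rw [Finset.sum_mul, Polynomial.finsetSum_coeff]
  refine Finset.sum_congr rfl fun n _ => ?_
  rw [positionPoly, termForm, LinearMap.sum_apply, Finset.mul_sum, Finset.mul_sum,
    Polynomial.finsetSum_coeff]
  refine Finset.sum_congr rfl fun p _ => ?_
  by_cases hj : p.2 = j
  · rw [if_pos hj, Polynomial.monomial_mul_X_pow, Polynomial.coeff_monomial]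
    by_cases h : n + p.1 < N
    · rw [dif_pos h]
      subst hj
      by_cases ht : (n : ℕ) + p.1 = t
      · have : t = ⟨n + p.1, h⟩ := Fin.ext ht.symm
        subst this
        simp
      · have : t ≠ ⟨n + p.1, h⟩ := fun h' => ht (by rw [h'])
        simp [ht, this.symm]
    · rw [dif_neg h, if_neg (by have := t.2; omega)]
      simp
  · rw [if_neg hj]
    split_ifs <;> simp [hj]

lemma coeff_positionPoly_mul_eq_zero {N F M : ℕ} (S : Finset (ℕ × Fin F))
    (hS : ∀ p ∈ S, M + p.1 ≤ N) (c : Fin M → ZMod 2) (j : Fin F) (t : ℕ) (ht : N ≤ t) :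
    ((∑ n : Fin M, Polynomial.monomial (n : ℕ) (c n)) * positionPoly S j).coeff t = 0 := by
  rw [Finset.sum_mul, Polynomial.finsetSum_coeff]
  refine Finset.sum_eq_zero fun n _ => ?_
  rw [positionPoly, Finset.mul_sum, Polynomial.finsetSum_coeff]
  refine Finset.sum_eq_zero fun p hp => ?_
  have := hS p hp
  have := n.2
  split_ifs
  · rw [Polynomial.monomial_mul_X_pow, Polynomial.coeff_monomial, if_neg (by omega)]
  · simp

lemma coeff_positionPoly {F : ℕ} (S : Finset (ℕ × Fin F)) (j : Fin F) (d : ℕ) :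
    (positionPoly S j).coeff d = if (d, j) ∈ S then 1 else 0 := by
  rw [positionPoly, Polynomial.finsetSum_coeff, ← Finset.sum_ite_eq' S (d, j) (fun _ => 1)]
  refine Finset.sum_congr rfl fun p _ => ?_
  by_cases hj : p.2 = j
  · simp [hj, Polynomial.coeff_X_pow, Prod.ext_iff, eq_comm]
  · simp [hj, Prod.ext_iff]

lemma positionPoly_injective {F : ℕ} {S S' : Finset (ℕ × Fin F)}
    (h : ∀ j, positionPoly S j = positionPoly S' j) : S = S' := by
  ext ⟨d, j⟩
  have := congrArg (fun q => q.coeff d) (h j)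
  simp only [coeff_positionPoly] at this
  by_cases h1 : (d, j) ∈ S <;> by_cases h2 : (d, j) ∈ S' <;> simp_all

lemma sum_monomial_eq_zero {M : ℕ} {c : Fin M → ZMod 2}
    (h : ∑ n : Fin M, Polynomial.monomial (n : ℕ) (c n) = 0) : c = 0 := by
  funext n
  have := congrArg (fun q => q.coeff n) h
  simpa [Polynomial.finsetSum_coeff, Polynomial.coeff_monomial, Fin.val_inj] using this

lemma LinearMap.surjective_of_forall_dual {K V W : Type*} [Field K] [AddCommGroup V] [Module K V]
    [AddCommGroup W] [Module K W] (f : V →ₗ[K] W)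
    (h : ∀ φ : W →ₗ[K] K, φ ∘ₗ f = 0 → φ = 0) : Function.Surjective f := by
  rw [← LinearMap.range_eq_top]
  by_contra hne
  obtain ⟨φ, hφ, hle⟩ := Submodule.exists_le_ker_of_lt_top _ (lt_top_iff_ne_top.2 hne)
  refine hφ (h φ ?_)
  ext v
  exact hle ⟨v, rfl⟩

/-- The vector of exponents of the first `M` terms of `corrSum`. -/
def termVec {N F : ℕ} (S : Finset (ℕ × Fin F)) (M : ℕ) :
    (Fin F → Fin N → ZMod 2) →ₗ[ZMod 2] (Fin M → ZMod 2) :=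
  LinearMap.pi fun n => termForm S n

lemma dual_apply_eq_sum {M : ℕ} (φ : (Fin M → ZMod 2) →ₗ[ZMod 2] ZMod 2) (y : Fin M → ZMod 2) :
    φ y = ∑ n, φ (Pi.single n 1) * y n := by
  conv_lhs => rw [← LinearMap.sum_single_apply (fun _ => ZMod 2) y, map_sum]
  refine Finset.sum_congr rfl fun n _ => ?_
  have : Pi.single n (y n) = y n • (Pi.single n 1 : Fin M → ZMod 2) := by
    rw [← Pi.single_smul]; simp
  simp [this, mul_comm]

lemma dual_eq_zero {M : ℕ} {φ : (Fin M → ZMod 2) →ₗ[ZMod 2] ZMod 2}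
    (h : ∑ n : Fin M, Polynomial.monomial (n : ℕ) (φ (Pi.single n 1)) = 0) : φ = 0 := by
  have h0 := sum_monomial_eq_zero h
  refine LinearMap.ext fun y => ?_
  rw [dual_apply_eq_sum]
  exact Finset.sum_eq_zero fun n _ => by
    rw [show φ (Pi.single n 1) = 0 from congrFun h0 n, zero_mul]

lemma positionPoly_combination_eq_zero {N F M : ℕ} {S S' : Finset (ℕ × Fin F)}
    (hS : ∀ p ∈ S, M + p.1 ≤ N) (hS' : ∀ p ∈ S', M + p.1 ≤ N)
    (φ ψ : (Fin M → ZMod 2) →ₗ[ZMod 2] ZMod 2)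
    (h : ∀ x : Fin F → Fin N → ZMod 2, φ (termVec S M x) + ψ (termVec S' M x) = 0) (j : Fin F) :
    (∑ n : Fin M, Polynomial.monomial (n : ℕ) (φ (Pi.single n 1))) * positionPoly S j +
      (∑ n : Fin M, Polynomial.monomial (n : ℕ) (ψ (Pi.single n 1))) * positionPoly S' j = 0 := by
  ext t
  rw [Polynomial.coeff_add, Polynomial.coeff_zero]
  by_cases ht : t < N
  · have := h (Pi.single j (Pi.single ⟨t, ht⟩ 1))
    rw [dual_apply_eq_sum, dual_apply_eq_sum ψ] at this
    rw [← this]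
    exact congrArg₂ (· + ·) (coeff_positionPoly_mul S (fun n => φ (Pi.single n 1)) j ⟨t, ht⟩)
      (coeff_positionPoly_mul S' (fun n => ψ (Pi.single n 1)) j ⟨t, ht⟩)
  · rw [coeff_positionPoly_mul_eq_zero S hS _ _ _ (not_lt.1 ht),
      coeff_positionPoly_mul_eq_zero S' hS' _ _ _ (not_lt.1 ht), add_zero]

lemma termVec_surjective {N F M : ℕ} {S : Finset (ℕ × Fin F)} (hne : S.Nonempty)
    (hS : ∀ p ∈ S, M + p.1 ≤ N) :
    Function.Surjective (termVec (N := N) S M) := by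
  refine LinearMap.surjective_of_forall_dual _ fun φ hφ => dual_eq_zero ?_
  obtain ⟨⟨d, j⟩, hp⟩ := hne
  have := positionPoly_combination_eq_zero hS hS φ 0
    (fun x => by simpa using LinearMap.congr_fun hφ x) j
  simp only [LinearMap.zero_apply, map_zero, Finset.sum_const_zero, zero_mul, add_zero] at this
  refine (mul_eq_zero.1 this).resolve_right fun h0 => ?_
  have := coeff_positionPoly S j d
  simp [h0, hp] at this

lemma termVec_prod_surjective {N F M : ℕ} {S S' : Finset (ℕ × Fin F)} (hne : S ≠ S')
    (hS : ∀ p ∈ S, M + p.1 ≤ N) (hS' : ∀ p ∈ S', M + p.1 ≤ N) {j : Fin F}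
    (hj : positionPoly S j = 1) (hj' : positionPoly S' j = 1) :
    Function.Surjective ((termVec (N := N) S M).prod (termVec S' M)) := by
  refine LinearMap.surjective_of_forall_dual _ fun φ hφ => ?_
  have key := positionPoly_combination_eq_zero hS hS' (φ ∘ₗ LinearMap.inl _ _ _)
    (φ ∘ₗ LinearMap.inr _ _ _) (fun x => by
      rw [LinearMap.comp_apply, LinearMap.comp_apply, ← map_add]
      simpa using LinearMap.congr_fun hφ x)
  set C := ∑ n : Fin M, Polynomial.monomial (n : ℕ) ((φ ∘ₗ LinearMap.inl _ _ _) (Pi.single n 1))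
    with hC
  set C' := ∑ n : Fin M, Polynomial.monomial (n : ℕ) ((φ ∘ₗ LinearMap.inr _ _ _) (Pi.single n 1))
    with hC'
  have h1 : C' = -C := by
    have := key j
    rw [hj, hj', mul_one, mul_one] at this
    exact (neg_eq_of_add_eq_zero_right this).symm
  have h2 : C = 0 := by
    by_contra hC0
    refine hne (positionPoly_injective fun i => ?_)
    have := key i
    rw [h1, neg_mul, ← sub_eq_add_neg, ← mul_sub] at this
    exact sub_eq_zero.1 ((mul_eq_zero.1 this).resolve_left hC0)
  have e1 := dual_eq_zero (hC ▸ h2)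
  have e2 := dual_eq_zero (hC' ▸ (by rw [h1, h2, neg_zero] : C' = 0))
  rw [← LinearMap.coprod_comp_inl_inr φ, e1, e2]
  ext <;> simp

lemma card_filter_comp_mul_card {V W : Type*} [AddGroup V] [AddGroup W] [Fintype V] [Fintype W]
    [DecidableEq W] (f : V →+ W) (hf : Function.Surjective f) (P : W → Prop) [DecidablePred P] :
    #{x | P (f x)} * Fintype.card W = #{y | P y} * Fintype.card V := by
  have hfib : ∀ y, #{x | f x = y} = #{x | f x = 0} := fun y =>
    AddMonoidHom.card_fiber_eq_of_mem_range f (hf y) (hf 0)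
  have hV : Fintype.card V = Fintype.card W * #{x | f x = 0} := by
    rw [← Finset.card_univ (α := V), Finset.card_eq_sum_card_fiberwise
      (f := f) (t := Finset.univ) (fun _ _ => Finset.mem_coe.2 (Finset.mem_univ _)),
      Finset.sum_congr rfl fun y _ => hfib y]
    simp
  have hP : #{x | P (f x)} = #{y | P y} * #{x | f x = 0} := by
    rw [Finset.card_eq_sum_card_fiberwise (f := f) (t := ({y | P y} : Finset W))
      (fun x hx => by simpa using hx), ← smul_eq_mul, ← Finset.sum_const]
    refine Finset.sum_congr rfl fun y hy => ?_
    rw [← hfib y, Finset.filter_filter]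
    congr 1
    ext x
    simp only [Finset.mem_filter, Finset.mem_univ, true_and] at hy ⊢
    exact ⟨fun h => h.2, fun h => ⟨h ▸ hy, h⟩⟩
  rw [hV, hP]
  ring

/-- Bitwise translation of Boolean sequences to sequences over `ZMod 2`. -/
def bitEquiv (N F : ℕ) : (Fin F → Fin N → Bool) ≃ (Fin F → Fin N → ZMod 2) :=
  Equiv.arrowCongr (Equiv.refl _) (Equiv.arrowCongr (Equiv.refl _) boolBit)

lemma corrSum_eq_sum_termVec {N F : ℕ} (ω : Fin F → Fin N → Bool) (S : Finset (ℕ × Fin F))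
    (M : ℕ) : corrSum ω S M = ∑ n, bitSign (termVec S M (bitEquiv N F ω) n) :=
  corrSum_eq_sum_bitSign ω S M

lemma card_corrSum_mul {N F M : ℕ} {S : Finset (ℕ × Fin F)} (hne : S.Nonempty)
    (hS : ∀ p ∈ S, M + p.1 ≤ N) (P : ℤ → Prop) [DecidablePred P] :
    #{ω : Fin F → Fin N → Bool | P (corrSum ω S M)} * 2 ^ M =
      #{y : Fin M → ZMod 2 | P (∑ n, bitSign (y n))} *
        Fintype.card (Fin F → Fin N → Bool) := by
  have := card_filter_comp_mul_card (termVec (N := N) S M).toAddMonoidHom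
    (termVec_surjective hne hS) (fun y => P (∑ n, bitSign (y n)))
  rw [Fintype.card_congr (bitEquiv N F), ← this]
  congr 1
  · refine Finset.card_equiv (bitEquiv N F) fun ω => ?_
    simp only [Finset.mem_filter, Finset.mem_univ, true_and, corrSum_eq_sum_termVec]
    rfl
  · simp [ZMod.card]

lemma card_corrSum_and_mul {N F M : ℕ} {S S' : Finset (ℕ × Fin F)} (hne : S ≠ S')
    (hS : ∀ p ∈ S, M + p.1 ≤ N) (hS' : ∀ p ∈ S', M + p.1 ≤ N) {j : Fin F}
    (hj : positionPoly S j = 1) (hj' : positionPoly S' j = 1) (P : ℤ → Prop) [DecidablePred P] :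
    #{ω : Fin F → Fin N → Bool | P (corrSum ω S M) ∧ P (corrSum ω S' M)} * (2 ^ M * 2 ^ M) =
      #{y : Fin M → ZMod 2 | P (∑ n, bitSign (y n))} *
        #{y : Fin M → ZMod 2 | P (∑ n, bitSign (y n))} *
        Fintype.card (Fin F → Fin N → Bool) := by
  have := card_filter_comp_mul_card
    ((termVec (N := N) S M).prod (termVec S' M)).toAddMonoidHom
    (termVec_prod_surjective hne hS hS' hj hj')
    (fun y => P (∑ n, bitSign (y.1 n)) ∧ P (∑ n, bitSign (y.2 n)))
  rw [← Finset.card_product, ← Finset.filter_product, Finset.univ_product_univ,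
    Fintype.card_congr (bitEquiv N F), ← this]
  congr 1
  · refine Finset.card_equiv (bitEquiv N F) fun ω => ?_
    simp only [Finset.mem_filter, Finset.mem_univ, true_and, corrSum_eq_sum_termVec]
    rfl
  · simp [ZMod.card]

lemma sum_exp_bitSign (M : ℕ) (t : ℝ) :
    ∑ y : Fin M → ZMod 2, Real.exp (t * (∑ n, bitSign (y n) : ℤ)) = (2 * Real.cosh t) ^ M := by
  have h2 : ∑ z : ZMod 2, Real.exp (t * bitSign z) = 2 * Real.cosh t := by
    rw [show (Finset.univ : Finset (ZMod 2)) = {0, 1} from rfl,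
      Finset.sum_pair (by decide), Real.cosh_eq]
    simp [bitSign]
    ring
  have := Finset.prod_univ_sum (fun _ : Fin M => (Finset.univ : Finset (ZMod 2)))
    (fun _ z => Real.exp (t * bitSign z))
  rw [Fintype.piFinset_univ, Finset.prod_const, h2, Finset.card_univ, Fintype.card_fin] at this
  rw [this]
  refine Finset.sum_congr rfl fun y _ => ?_
  rw [← Real.exp_sum]
  push_cast
  rw [Finset.mul_sum]

lemma card_le_abs_sum_bitSign (M : ℕ) (hM : 0 < M) (x : ℝ) (hx : 0 ≤ x) :
    (#{y : Fin M → ZMod 2 | x ≤ ((∑ n, bitSign (y n)).natAbs : ℝ)} : ℝ) ≤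
      2 * 2 ^ M * Real.exp (-(x ^ 2 / (2 * M))) := by
  have hM' : (0 : ℝ) < M := by exact_mod_cast hM
  set t : ℝ := x / M with ht
  have ht0 : 0 ≤ t := by positivity
  have hcosh : (2 * Real.cosh t) ^ M ≤ 2 ^ M * Real.exp (x ^ 2 / (2 * M)) := by
    rw [mul_pow]
    gcongr
    calc Real.cosh t ^ M ≤ Real.exp (t ^ 2 / 2) ^ M := by
          gcongr
          exact Real.cosh_le_exp_half_sq t
      _ = Real.exp (x ^ 2 / (2 * M)) := by
          rw [← Real.exp_nat_mul, ht]
          congr 1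
          field_simp
  have key : (#{y : Fin M → ZMod 2 | x ≤ ((∑ n, bitSign (y n)).natAbs : ℝ)} : ℝ) *
      Real.exp (t * x) ≤ 2 * (2 * Real.cosh t) ^ M := by
    rw [← nsmul_eq_mul, ← Finset.sum_const]
    calc _ ≤ ∑ y ∈ ({y : Fin M → ZMod 2 | x ≤ ((∑ n, bitSign (y n)).natAbs : ℝ)} : Finset _),
          (Real.exp (t * (∑ n, bitSign (y n) : ℤ)) +
            Real.exp (-t * (∑ n, bitSign (y n) : ℤ))) := by
          refine Finset.sum_le_sum fun y hy => ?_
          simp only [Finset.mem_filter, Finset.mem_univ, true_and, Nat.cast_natAbs] at hy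
          push_cast at hy ⊢
          rcases le_abs'.1 hy with h | h
          · have : Real.exp (t * x) ≤ Real.exp (-t * ∑ n, (bitSign (y n) : ℝ)) :=
              Real.exp_le_exp.2 (by nlinarith)
            linarith [Real.exp_pos (t * ∑ n, (bitSign (y n) : ℝ))]
          · have : Real.exp (t * x) ≤ Real.exp (t * ∑ n, (bitSign (y n) : ℝ)) := by
              gcongr
            linarith [Real.exp_pos (-t * ∑ n, (bitSign (y n) : ℝ))]
      _ ≤ ∑ y : Fin M → ZMod 2, (Real.exp (t * (∑ n, bitSign (y n) : ℤ)) +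
            Real.exp (-t * (∑ n, bitSign (y n) : ℤ))) :=
          Finset.sum_le_sum_of_subset_of_nonneg (Finset.subset_univ _) fun _ _ _ => by positivity
      _ = 2 * (2 * Real.cosh t) ^ M := by
          rw [Finset.sum_add_distrib, sum_exp_bitSign, sum_exp_bitSign, Real.cosh_neg]
          ring
  have htx : Real.exp (t * x) = Real.exp (x ^ 2 / (2 * M)) * Real.exp (x ^ 2 / (2 * M)) := by
    rw [← Real.exp_add, ht]
    congr 1
    field_simp
    ring
  rw [Real.exp_neg, ← div_eq_mul_inv, le_div_iff₀ (Real.exp_pos _)]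
  rw [htx, ← mul_assoc] at key
  have h3 := key.trans (mul_le_mul_of_nonneg_left hcosh zero_le_two)
  rw [← mul_assoc] at h3
  exact le_of_mul_le_mul_right h3 (Real.exp_pos _)

lemma choose_le_card_sum_bitSign (m j : ℕ) :
    (2 * m).choose (m + j) ≤
      #{y : Fin (2 * m) → ZMod 2 | ∑ n, bitSign (y n) = 2 * (j : ℤ)} := by
  calc (2 * m).choose (m + j)
      = #((Finset.univ : Finset (Fin (2 * m))).powersetCard (m + j)) := by simp
    _ ≤ _ := by
      refine Finset.card_le_card_of_injOn (fun A n => if n ∈ A then 0 else 1) ?_ ?_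
      · intro A hA
        have hA := (Finset.mem_powersetCard.1 hA).2
        simp only [Finset.coe_filter, Finset.mem_univ, true_and, Set.mem_ofPred_eq]
        have : ∀ n : Fin (2 * m), bitSign (if n ∈ A then 0 else 1) =
            2 * (if n ∈ A then 1 else 0) - 1 := fun n => by
          split_ifs <;> simp [bitSign]
        rw [Finset.sum_congr rfl fun n _ => this n, Finset.sum_sub_distrib, ← Finset.mul_sum]
        simp [hA]
        ring
      · intro A _ B _ h
        ext n
        have := congrFun h n
        by_cases h1 : n ∈ A <;> by_cases h2 : n ∈ B <;> simp_all

lemma card_avoiding_mul_le {Ω ι : Type*} [Fintype Ω] [DecidableEq Ω] [DecidableEq ι]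
    (s : Finset ι) (A : ι → Finset Ω) (p : ℝ) (hp : 0 ≤ p)
    (h1 : ∀ i ∈ s, (#(A i) : ℝ) = p * Fintype.card Ω)
    (h2 : ∀ i ∈ s, ∀ j ∈ s, i ≠ j → (#(A i ∩ A j) : ℝ) = p ^ 2 * Fintype.card Ω) :
    (#{ω | ∀ i ∈ s, ω ∉ A i} : ℝ) * (#s * p) ≤ Fintype.card Ω := by
  set Z : Ω → ℝ := fun ω => ∑ i ∈ s, if ω ∈ A i then 1 else 0 with hZ
  set c : ℝ := (Fintype.card Ω : ℝ) with hc
  have hsum : ∑ ω, Z ω = #s * (p * c) := by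
    rw [Finset.sum_comm, Finset.sum_congr rfl fun i hi => ?_, Finset.sum_const, nsmul_eq_mul]
    rw [← h1 i hi]
    simp
  have hsq : ∑ ω, Z ω ^ 2 ≤ #s * (p * c) + #s * #s * (p ^ 2 * c) := by
    have : ∀ ω, Z ω ^ 2 = ∑ i ∈ s, ∑ j ∈ s, if ω ∈ A i ∩ A j then 1 else 0 := fun ω => by
      rw [hZ, sq, Finset.sum_mul_sum]
      refine Finset.sum_congr rfl fun i _ => Finset.sum_congr rfl fun j _ => ?_
      by_cases hi : ω ∈ A i <;> by_cases hj : ω ∈ A j <;> simp [hi, hj]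
    rw [Finset.sum_congr rfl fun ω _ => this ω, Finset.sum_comm]
    have : ∀ i ∈ s, ∑ ω, ∑ j ∈ s, (if ω ∈ A i ∩ A j then (1 : ℝ) else 0) ≤
        p * c + #s * (p ^ 2 * c) := fun i hi => by
      rw [Finset.sum_comm]
      calc ∑ j ∈ s, ∑ ω, (if ω ∈ A i ∩ A j then (1 : ℝ) else 0)
          = ∑ j ∈ s, (#(A i ∩ A j) : ℝ) := Finset.sum_congr rfl fun j _ => by
            rw [Finset.sum_boole, Finset.filter_univ_mem]
        _ ≤ ∑ j ∈ s, ((if i = j then p * c else 0) + p ^ 2 * c) := by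
          refine Finset.sum_le_sum fun j hj => ?_
          split_ifs with hij
          · subst hij
            rw [Finset.inter_self, h1 i hi]
            exact le_add_of_nonneg_right (by positivity)
          · rw [h2 i hi j hj hij, zero_add]
        _ = p * c + #s * (p ^ 2 * c) := by
          rw [Finset.sum_add_distrib, Finset.sum_ite_eq, if_pos hi]
          simp
    refine (Finset.sum_le_sum this).trans_eq ?_
    rw [Finset.sum_const, nsmul_eq_mul]
    ring
  have hvar : (#{ω | ∀ i ∈ s, ω ∉ A i} : ℝ) * (#s * p) ^ 2 ≤ #s * p * c := by
    calc (#{ω | ∀ i ∈ s, ω ∉ A i} : ℝ) * (#s * p) ^ 2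
        = ∑ ω ∈ {ω | ∀ i ∈ s, ω ∉ A i}, (Z ω - #s * p) ^ 2 := by
          rw [← nsmul_eq_mul, ← Finset.sum_const]
          refine Finset.sum_congr rfl fun ω hω => ?_
          have : Z ω = 0 := Finset.sum_eq_zero fun i hi =>
            if_neg ((Finset.mem_filter.1 hω).2 i hi)
          rw [this]
          ring
      _ ≤ ∑ ω, (Z ω - #s * p) ^ 2 :=
          Finset.sum_le_sum_of_subset_of_nonneg (Finset.subset_univ _) fun _ _ _ => sq_nonneg _
      _ = ∑ ω, Z ω ^ 2 - 2 * (#s * p) * ∑ ω, Z ω + c * (#s * p) ^ 2 := by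
          have hconst : c * (#s * p) ^ 2 = ∑ _ω : Ω, (#s * p) ^ 2 := by
            rw [Finset.sum_const, nsmul_eq_mul, Finset.card_univ]
          rw [Finset.mul_sum, ← Finset.sum_sub_distrib, hconst, ← Finset.sum_add_distrib]
          exact Finset.sum_congr rfl fun ω _ => by ring
      _ ≤ #s * p * c := by rw [hsum]; nlinarith
  rcases (by positivity : (0 : ℝ) ≤ #s * p).eq_or_lt with h0 | h0
  · rw [← h0, mul_zero]
    positivity
  · refine le_of_mul_le_mul_left ?_ h0
    nlinarith

lemma exists_corrSum_of_mem_famCorrSet {N F k v : ℕ} {ω : Fin F → Fin N → Bool}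
    (hv : v ∈ famCorrSet k (Finset.univ.image ω)) :
    ∃ (S : Finset (ℕ × Fin F)) (M : ℕ), #S = k ∧ 1 ≤ M ∧ (∀ p ∈ S, M + p.1 ≤ N) ∧
      v = (corrSum ω S M).natAbs := by
  obtain ⟨E, d, M, hE, -, hM, hd, hne, rfl⟩ := hv
  have hE' : ∀ i, ∃ j, ω j = E i := fun i => by simpa using hE i
  choose J hJ using hE'
  have hinj : Function.Injective fun i => (d i, J i) := fun a b hab => by
    by_contra hne'
    obtain ⟨h1, h2⟩ := Prod.ext_iff.1 hab
    exact hne a b hne' (by rw [← hJ, ← hJ]; exact congrArg ω h2) h1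
  refine ⟨Finset.univ.image fun i => (d i, J i), M, ?_, hM, ?_, ?_⟩
  · rw [Finset.card_image_of_injective _ hinj, Finset.card_univ, Fintype.card_fin]
  · simpa using hd
  · rw [corrSum]
    congr 1
    refine Finset.sum_congr rfl fun n _ => ?_
    rw [Finset.prod_image fun a _ b _ h => hinj h]
    exact Finset.prod_congr rfl fun i _ => by rw [hJ]

lemma natAbs_corrSum_mem_famCorrSet {N F M : ℕ} {ω : Fin F → Fin N → Bool}
    (hω : Function.Injective ω) (S : Finset (ℕ × Fin F)) (hM : 1 ≤ M)
    (hS : ∀ p ∈ S, M + p.1 ≤ N) :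
    (corrSum ω S M).natAbs ∈ famCorrSet #S (Finset.univ.image ω) := by
  set L : Finset (ℕ ×ₗ Fin F) := S.map toLex.toEmbedding with hL
  have hcard : #L = #S := Finset.card_map _
  set e := L.orderEmbOfFin hcard with he
  have hmem : ∀ i, ofLex (e i) ∈ S := fun i => by
    obtain ⟨p, hp, hpe⟩ := Finset.mem_map.1 (L.orderEmbOfFin_mem hcard i)
    have : ofLex (e i) = p := by
      rw [he, ← hpe]
      rfl
    rwa [this]
  refine ⟨fun i => ω (ofLex (e i)).2, fun i => (ofLex (e i)).1, M, ?_, ?_, hM,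
    fun i => hS _ (hmem i), ?_, ?_⟩
  · exact fun i => Finset.mem_image_of_mem _ (Finset.mem_univ _)
  · exact fun a b hab => Prod.Lex.monotone_fst _ _ (e.monotone hab)
  · intro a b hab h1 h2
    exact hab (e.injective (ofLex.injective (Prod.ext h2 (hω h1))))
  · rw [corrSum]
    congr 1
    refine Finset.sum_congr rfl fun n _ => ?_
    have himg : S = Finset.univ.image fun i => ofLex (e i) := by
      refine (Finset.eq_of_subset_of_card_le (fun p hp => ?_) ?_).symm
      · obtain ⟨i, -, rfl⟩ := Finset.mem_image.1 hp
        exact hmem i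
      · rw [Finset.card_image_of_injective _ fun a b h => e.injective (ofLex.injective h)]
        simp
    conv_lhs => rw [himg]
    exact Finset.prod_image fun a _ b _ h => e.injective (ofLex.injective h)

lemma abs_seqAt {N : ℕ} (E : Fin N → Bool) (t : ℕ) : |seqAt E t| = 1 := by
  unfold seqAt pmVal
  split_ifs <;> simp

lemma bddAbove_famCorrSet {N : ℕ} (k : ℕ) (A : Finset (Fin N → Bool)) (hk : 0 < k) :
    BddAbove (famCorrSet k A) := by
  refine ⟨N, ?_⟩
  rintro v ⟨E, d, M, -, -, -, hd, -, rfl⟩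
  have hM : M ≤ N := le_of_add_le_left (hd ⟨0, hk⟩)
  have : |∑ n ∈ Finset.range M, ∏ i, seqAt (E i) (n + d i)| ≤ M := by
    refine (Finset.abs_sum_le_sum_abs _ _).trans ?_
    simp [Finset.abs_prod, abs_seqAt]
  rw [Int.abs_eq_natAbs] at this
  omega

open Classical in
lemma card_exists_le_corrSum {N F k : ℕ} (hk : 0 < k) (U : ℝ) (hU : 0 ≤ U) :
    (#{ω : Fin F → Fin N → Bool | ∃ (S : Finset (ℕ × Fin F)) (M : ℕ), #S = k ∧ 1 ≤ M ∧
      (∀ p ∈ S, M + p.1 ≤ N) ∧ U ≤ ((corrSum ω S M).natAbs : ℝ)} : ℝ) ≤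
      (N * F).choose k * N * (2 * Real.exp (-(U ^ 2 / (2 * N)))) *
        Fintype.card (Fin F → Fin N → Bool) := by
  set I := (((Finset.range N ×ˢ (Finset.univ : Finset (Fin F))).powersetCard k) ×ˢ
    Finset.Icc 1 N).filter fun q => ∀ p ∈ q.1, q.2 + p.1 ≤ N with hI
  have hsub : ({ω : Fin F → Fin N → Bool | ∃ (S : Finset (ℕ × Fin F)) (M : ℕ), #S = k ∧ 1 ≤ M ∧
      (∀ p ∈ S, M + p.1 ≤ N) ∧ U ≤ ((corrSum ω S M).natAbs : ℝ)} : Finset _) ⊆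
      I.biUnion fun q => {ω | U ≤ ((corrSum ω q.1 q.2).natAbs : ℝ)} := by
    intro ω hω
    obtain ⟨S, M, hS, hM, hle, hU'⟩ := (Finset.mem_filter.1 hω).2
    refine Finset.mem_biUnion.2 ⟨(S, M), ?_, by simpa using hU'⟩
    obtain ⟨p, hp⟩ := Finset.card_pos.1 (hS ▸ hk)
    have hMN : M ≤ N := le_of_add_le_left (hle p hp)
    simp only [hI, Finset.mem_filter, Finset.mem_product, Finset.mem_powersetCard,
      Finset.mem_Icc]
    refine ⟨⟨⟨fun p hp => ?_, hS⟩, hM, hMN⟩, hle⟩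
    have := hle p hp
    simp only [Finset.mem_product, Finset.mem_range, Finset.mem_univ, and_true]
    omega
  have hone : ∀ q ∈ I, (#{ω : Fin F → Fin N → Bool | U ≤ ((corrSum ω q.1 q.2).natAbs : ℝ)} : ℝ) ≤
      2 * Real.exp (-(U ^ 2 / (2 * N))) * Fintype.card (Fin F → Fin N → Bool) := by
    rintro ⟨S, M⟩ hq
    simp only [hI, Finset.mem_filter, Finset.mem_product, Finset.mem_powersetCard,
      Finset.mem_Icc] at hq
    obtain ⟨⟨⟨-, hS⟩, hM, hMN⟩, hle⟩ := hq
    have h1 := card_corrSum_mul (Finset.card_pos.1 (hS ▸ hk)) hle (fun z => U ≤ (z.natAbs : ℝ))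
    have h2 := card_le_abs_sum_bitSign M hM U hU
    have h3 : Real.exp (-(U ^ 2 / (2 * M))) ≤ Real.exp (-(U ^ 2 / (2 * N))) := by
      have : (0 : ℝ) < M := by exact_mod_cast hM
      have : (M : ℝ) ≤ N := by exact_mod_cast hMN
      refine Real.exp_le_exp.2 (neg_le_neg ?_)
      gcongr
    have h1' : (#{ω : Fin F → Fin N → Bool | U ≤ ((corrSum ω S M).natAbs : ℝ)} : ℝ) * 2 ^ M =
        #{y : Fin M → ZMod 2 | U ≤ ((∑ n, bitSign (y n)).natAbs : ℝ)} *
          Fintype.card (Fin F → Fin N → Bool) := by exact_mod_cast h1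
    refine le_of_mul_le_mul_right (a := (2 : ℝ) ^ M) ?_ (by positivity)
    rw [h1']
    calc _ ≤ 2 * 2 ^ M * Real.exp (-(U ^ 2 / (2 * N))) *
          (Fintype.card (Fin F → Fin N → Bool) : ℝ) := by
          gcongr
          exact h2.trans (by gcongr)
      _ = _ := by ring
  have hcardI : (#I : ℝ) ≤ (N * F).choose k * N := by
    have := Finset.card_filter_le (((Finset.range N ×ˢ
      (Finset.univ : Finset (Fin F))).powersetCard k) ×ˢ Finset.Icc 1 N)
      fun q => ∀ p ∈ q.1, q.2 + p.1 ≤ N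
    rw [Finset.card_product, Finset.card_powersetCard, Finset.card_product] at this
    simp only [Finset.card_range, Finset.card_univ, Fintype.card_fin, Nat.card_Icc,
      Nat.add_sub_cancel] at this
    exact_mod_cast this
  calc _ ≤ ((∑ q ∈ I, #{ω : Fin F → Fin N → Bool |
        U ≤ ((corrSum ω q.1 q.2).natAbs : ℝ)} : ℕ) : ℝ) := by
        exact_mod_cast (Finset.card_le_card hsub).trans Finset.card_biUnion_le
    _ ≤ #I * (2 * Real.exp (-(U ^ 2 / (2 * N))) * Fintype.card (Fin F → Fin N → Bool)) := by
        push_cast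
        rw [← nsmul_eq_mul]
        exact Finset.sum_le_card_nsmul _ _ _ hone
    _ ≤ _ := by
        rw [mul_assoc ((N * F).choose k * N : ℝ)]
        gcongr

lemma positionPoly_insert_eq_one {G : ℕ} {A : Finset (ℕ × Fin (G + 1))}
    (hA : ∀ p ∈ A, p.2 ≠ 0) : positionPoly (insert (0, 0) A) 0 = 1 := by
  ext d
  rw [coeff_positionPoly, Polynomial.coeff_one]
  congr 1
  rw [Finset.mem_insert, Prod.mk_inj, eq_self, and_true, eq_iff_iff]
  exact or_iff_left fun h => hA _ h rfl

open Classical in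
lemma card_forall_corrSum_ne_mul {N G W m r : ℕ} (j : ℕ) (hN : W + 2 * m ≤ N) :
    (#{ω : Fin (G + 1) → Fin N → Bool | ∀ S : Finset (ℕ × Fin (G + 1)), #S = r + 1 →
      (∀ p ∈ S, 2 * m + p.1 ≤ N) → corrSum ω S (2 * m) ≠ 2 * (j : ℤ)} : ℝ) *
      ((W * G).choose r * ((2 * m).choose (m + j) / 4 ^ m)) ≤
      Fintype.card (Fin (G + 1) → Fin N → Bool) := by
  set T := ((Finset.range W ×ˢ (Finset.univ.erase (0 : Fin (G + 1)))).powersetCard r) with hT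
  set p : ℝ := #{y : Fin (2 * m) → ZMod 2 | ∑ n, bitSign (y n) = 2 * (j : ℤ)} / 2 ^ (2 * m)
    with hp
  have h2 : (2 : ℝ) ^ (2 * m) = 4 ^ m := by rw [pow_mul]; norm_num
  have hcardT : #T = (W * G).choose r := by
    rw [hT, Finset.card_powersetCard, Finset.card_product, Finset.card_erase_of_mem (by simp)]
    simp
  have hA0 : ∀ A ∈ T, ∀ q ∈ A, q.2 ≠ 0 := fun A hA q hq => by
    have := (Finset.mem_powersetCard.1 hA).1 hq
    simp at this
    exact this.2
  have hAN : ∀ A ∈ T, ∀ q ∈ insert (0, 0) A, 2 * m + q.1 ≤ N := fun A hA q hq => by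
    rcases Finset.mem_insert.1 hq with rfl | hq
    · simp only; omega
    · have := (Finset.mem_powersetCard.1 hA).1 hq
      simp at this
      omega
  have hAne : ∀ A ∈ T, ((0, 0) : ℕ × Fin (G + 1)) ∉ A := fun A hA h => hA0 A hA _ h rfl
  have key := card_avoiding_mul_le T
    (fun A => {ω : Fin (G + 1) → Fin N → Bool |
      corrSum ω (insert (0, 0) A) (2 * m) = 2 * (j : ℤ)}) p (by positivity) ?_ ?_
  · rw [hcardT] at key
    refine le_trans (mul_le_mul (Nat.cast_le.2 (Finset.card_le_card fun ω hω => ?_))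
      (mul_le_mul_of_nonneg_left ?_ (by positivity)) (by positivity) (by positivity)) key
    · rw [Finset.mem_filter_univ] at hω ⊢
      intro A hA
      rw [Finset.mem_filter_univ]
      exact hω _ (by
        rw [Finset.card_insert_of_notMem (hAne A hA), (Finset.mem_powersetCard.1 hA).2])
        (hAN A hA)
    · rw [hp, h2]
      gcongr
      exact choose_le_card_sum_bitSign m j
  · intro A hA
    have := card_corrSum_mul (Finset.insert_nonempty _ _) (hAN A hA)
      (fun z => z = 2 * (j : ℤ))
    rw [hp, div_mul_eq_mul_div, eq_div_iff (by positivity)]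
    exact_mod_cast this
  · intro A hA B hB hAB
    have hne : insert ((0, 0) : ℕ × Fin (G + 1)) A ≠ insert (0, 0) B := fun h => hAB (by
      rw [← Finset.erase_insert (hAne A hA), h, Finset.erase_insert (hAne B hB)])
    have := card_corrSum_and_mul hne (hAN A hA) (hAN B hB)
      (positionPoly_insert_eq_one (hA0 A hA)) (positionPoly_insert_eq_one (hA0 B hB))
      (fun z => z = 2 * (j : ℤ))
    rw [hp, div_pow, div_mul_eq_mul_div, eq_div_iff (by positivity), sq, sq,
      ← Finset.filter_and]
    exact_mod_cast this

lemma four_pow_le_two_mul_sqrt_mul_centralBinom (m : ℕ) (hm : 0 < m) :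
    (4 : ℝ) ^ m ≤ 2 * √m * m.centralBinom := by
  have hsq : 16 ^ m ≤ 4 * m * m.centralBinom ^ 2 := by
    induction m, hm using Nat.le_induction with
    | base => simp [Nat.centralBinom]
    | succ n hn ih =>
      have hrec := Nat.succ_mul_centralBinom_succ n
      refine Nat.le_of_mul_le_mul_left ?_ (show 0 < n * (n + 1) by positivity)
      calc n * (n + 1) * 16 ^ (n + 1) = 16 * n * (n + 1) * 16 ^ n := by ring
        _ ≤ 16 * n * (n + 1) * (4 * n * n.centralBinom ^ 2) := by gcongr
        _ ≤ 4 * n * (2 * (2 * n + 1) * n.centralBinom) ^ 2 := by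
          have : 4 * n * (n + 1) ≤ (2 * n + 1) ^ 2 := by nlinarith
          calc _ = 16 * n * n.centralBinom ^ 2 * (4 * n * (n + 1)) := by ring
            _ ≤ 16 * n * n.centralBinom ^ 2 * (2 * n + 1) ^ 2 := by gcongr
            _ = _ := by ring
        _ = 4 * n * ((n + 1) * (n + 1).centralBinom) ^ 2 := by rw [← hrec]
        _ = _ := by ring
  have hsq' : (16 : ℝ) ^ m ≤ 4 * m * m.centralBinom ^ 2 := by exact_mod_cast hsq
  refine abs_le_of_sq_le_sq' ?_ (by positivity) |>.2
  rw [mul_pow, mul_pow, Real.sq_sqrt (by positivity), ← pow_mul, mul_comm m, pow_mul]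
  norm_num
  exact hsq'

lemma choose_mul_descFactorial {m j : ℕ} (hj : j ≤ m) :
    (2 * m).choose (m + j) * (m + j).descFactorial j = m.centralBinom * m.descFactorial j := by
  have h1 := Nat.choose_mul_factorial_mul_factorial (show m + j ≤ 2 * m by omega)
  have h2 := Nat.choose_mul_factorial_mul_factorial (show m ≤ 2 * m by omega)
  have h3 := Nat.factorial_mul_descFactorial hj
  have h4 := Nat.factorial_mul_descFactorial (show j ≤ m + j by omega)
  rw [show 2 * m - (m + j) = m - j by omega] at h1
  rw [show 2 * m - m = m by omega] at h2
  rw [Nat.add_sub_cancel] at h4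
  refine Nat.eq_of_mul_eq_mul_right (show 0 < m.factorial * (m - j).factorial by positivity) ?_
  calc _ = (2 * m).choose (m + j) * (m.factorial * (m + j).descFactorial j) *
        (m - j).factorial := by ring
    _ = (2 * m).choose m * m.factorial * m.factorial := by rw [h4, h1, h2]
    _ = (2 * m).choose m * m.factorial * ((m - j).factorial * m.descFactorial j) := by rw [h3]
    _ = _ := by rw [Nat.centralBinom]; ring

lemma centralBinom_mul_pow_le_choose {m j : ℕ} (hj : j ≤ m) :
    (m.centralBinom : ℝ) * (1 - j / (m + 1)) ^ j ≤ (2 * m).choose (m + j) := by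
  have hprod : (m + 1 - j) ^ j * (m + j).descFactorial j ≤ (m + 1) ^ j * m.descFactorial j := by
    rw [Nat.descFactorial_eq_prod_range, Nat.descFactorial_eq_prod_range,
      ← Finset.card_range j, ← Finset.prod_const, ← Finset.prod_const, Finset.card_range,
      ← Finset.prod_mul_distrib, ← Finset.prod_mul_distrib]
    refine Finset.prod_le_prod' fun i hi => ?_
    have hi := Finset.mem_range.1 hi
    obtain ⟨a, rfl⟩ := Nat.exists_eq_add_of_lt hi
    obtain ⟨b, rfl⟩ := Nat.exists_eq_add_of_le hj
    rw [show i + a + 1 + b + 1 - (i + a + 1) = b + 1 by omega,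
      show i + a + 1 + b + (i + a + 1) - i = i + a + 1 + b + a + 1 by omega,
      show i + a + 1 + b - i = a + 1 + b by omega]
    nlinarith [Nat.zero_le (i * a)]
  have hd : (0 : ℝ) < (m + j).descFactorial j := by
    exact_mod_cast Nat.pos_of_ne_zero fun h => by
      rw [Nat.descFactorial_eq_zero_iff_lt] at h
      omega
  refine le_of_mul_le_mul_right ?_ hd
  rw [← Nat.cast_mul, choose_mul_descFactorial hj, Nat.cast_mul, mul_assoc]
  gcongr
  have hm : (0 : ℝ) < m + 1 := by positivity
  rw [show (1 : ℝ) - j / (m + 1) = (m + 1 - j) / (m + 1) by field_simp, div_pow,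
    div_mul_eq_mul_div, div_le_iff₀ (by positivity), mul_comm _ (((m : ℝ) + 1) ^ j)]
  have hcast : ((m + 1 - j : ℕ) : ℝ) = m + 1 - j := by
    rw [Nat.cast_sub (by omega)]
    push_cast
    ring
  rw [← hcast]
  exact_mod_cast hprod

lemma exp_neg_le_one_sub {y : ℝ} (h0 : 0 ≤ y) (h1 : y ≤ 11 / 20) :
    Real.exp (-(3 / 2 * y)) ≤ 1 - y := by
  have h := Real.sum_le_exp_of_nonneg (show 0 ≤ 3 / 2 * y by positivity) 4
  simp [Finset.sum_range_succ, Nat.factorial] at h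
  rw [Real.exp_neg, inv_le_comm₀ (Real.exp_pos _) (by linarith)]
  refine le_trans ?_ h
  rw [inv_le_iff_one_le_mul₀ (by linarith)]
  have h2 : 0 ≤ y * (11 / 20 - y) := mul_nonneg h0 (by linarith)
  have h3 : 0 ≤ y * y * (11 / 20 - y) := mul_nonneg (by positivity) (by linarith)
  have h4 : 0 ≤ y * y * y * (11 / 20 - y) := mul_nonneg (by positivity) (by linarith)
  nlinarith

lemma le_log_choose_div_four_pow {m j : ℕ} (hm : 0 < m) (hj : (j : ℝ) / (m + 1) ≤ 11 / 20) :
    0 < ((2 * m).choose (m + j) : ℝ) / 4 ^ m ∧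
    -(3 / 2 * (j ^ 2 / (m + 1))) - Real.log 2 - Real.log m / 2 ≤
      Real.log ((2 * m).choose (m + j) / 4 ^ m : ℝ) := by
  have hm' : (0 : ℝ) < m := by exact_mod_cast hm
  have hjm : j ≤ m := by
    rw [div_le_iff₀ (by positivity)] at hj
    have : (j : ℝ) < m + 1 := by linarith
    exact Nat.lt_succ_iff.1 (by exact_mod_cast this)
  have hpos : (0 : ℝ) < (2 * m).choose (m + j) := by
    exact_mod_cast Nat.choose_pos (by omega)
  refine ⟨by positivity, ?_⟩
  rw [Real.le_log_iff_exp_le (by positivity), sub_sub, sub_eq_add_neg, Real.exp_add,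
    Real.exp_neg (Real.log 2 + _), Real.exp_add, Real.exp_log (by norm_num),
    show Real.log m / 2 = Real.log √m by rw [Real.log_sqrt hm'.le], Real.exp_log (by positivity),
    ← div_eq_mul_inv, div_le_div_iff₀ (by positivity) (by positivity)]
  have h1 : Real.exp (-(3 / 2 * (j ^ 2 / (m + 1)))) ≤ (1 - (j : ℝ) / (m + 1)) ^ j := by
    calc _ = Real.exp (-(3 / 2 * (j / (m + 1)))) ^ j := by
          rw [← Real.exp_nat_mul]
          congr 1
          ring
      _ ≤ _ := by
          gcongr
          exact exp_neg_le_one_sub (by positivity) hj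
  have h2 := centralBinom_mul_pow_le_choose hjm
  have h3 := four_pow_le_two_mul_sqrt_mul_centralBinom m hm
  have h0 : 0 ≤ (1 - (j : ℝ) / (m + 1)) ^ j := (Real.exp_pos _).le.trans h1
  calc _ ≤ (1 - (j : ℝ) / (m + 1)) ^ j * (2 * √m * m.centralBinom) := by gcongr
    _ = m.centralBinom * (1 - (j : ℝ) / (m + 1)) ^ j * (2 * √m) := by ring
    _ ≤ _ := by gcongr

lemma choose_mul_self_eq {n k : ℕ} (hn : 0 < n) (hk : 0 < k) :
    n.choose k * k = n * (n - 1).choose (k - 1) := by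
  obtain ⟨n, rfl⟩ := Nat.exists_eq_succ_of_ne_zero hn.ne'
  obtain ⟨k, rfl⟩ := Nat.exists_eq_succ_of_ne_zero hk.ne'
  exact (Nat.add_one_mul_choose_eq n k).symm

lemma pow_le_choose_of_mul_le {c n k : ℕ} (h : c * k ≤ n) : c ^ k ≤ n.choose k := by
  rcases Nat.eq_zero_or_pos c with rfl | hc
  · rcases k with _ | k <;> simp
  induction k generalizing n with
  | zero => simp
  | succ k ih =>
    have hn : 0 < n := lt_of_lt_of_le (by positivity) h
    have h' : c * k ≤ n - 1 := by
      rw [mul_add] at h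
      omega
    refine Nat.le_of_mul_le_mul_right ?_ (show 0 < k + 1 by positivity)
    rw [choose_mul_self_eq hn (by positivity), Nat.add_sub_cancel]
    calc c ^ (k + 1) * (k + 1) = c * (k + 1) * c ^ k := by ring
      _ ≤ n * (n - 1).choose k := Nat.mul_le_mul h (ih h')

lemma choose_le_pow_mul_choose {a b c r : ℕ} (h : ∀ i < r, a - i ≤ c * (b - i)) :
    a.choose r ≤ c ^ r * b.choose r := by
  refine Nat.le_of_mul_le_mul_left ?_ r.factorial_pos
  rw [← Nat.descFactorial_eq_factorial_mul_choose, mul_left_comm,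
    ← Nat.descFactorial_eq_factorial_mul_choose, Nat.descFactorial_eq_prod_range,
    Nat.descFactorial_eq_prod_range]
  calc _ ≤ ∏ i ∈ Finset.range r, c * (b - i) :=
        Finset.prod_le_prod' fun i hi => h i (Finset.mem_range.1 hi)
    _ = _ := by rw [Finset.prod_mul_distrib, Finset.prod_const, Finset.card_range]

lemma pow_mul_choose_le_choose_mul (G W r : ℕ) :
    G ^ r * W.choose r ≤ (W * G).choose r := by
  rcases Nat.eq_zero_or_pos G with rfl | hG
  · rcases r with _ | r <;> simp
  refine Nat.le_of_mul_le_mul_left ?_ r.factorial_pos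
  rw [← Nat.descFactorial_eq_factorial_mul_choose, mul_left_comm,
    ← Nat.descFactorial_eq_factorial_mul_choose, Nat.descFactorial_eq_prod_range,
    Nat.descFactorial_eq_prod_range]
  calc _ = ∏ i ∈ Finset.range r, G * (W - i) := by
        rw [Finset.prod_mul_distrib, Finset.prod_const, Finset.card_range]
    _ ≤ _ := Finset.prod_le_prod' fun i _ => by
        rw [Nat.mul_sub, mul_comm G W]
        exact Nat.sub_le_sub_left (Nat.le_mul_of_pos_left _ hG) _

lemma choose_mul_exp_le {N F k : ℕ} (hk : 2 ≤ k) (hF : 2 ≤ F) (hN : 6 * k ≤ N) :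
    ((N * F).choose k : ℝ) * N * (2 * Real.exp (-((5 / 2 * √(N * (Real.log (N.choose k) +
      k * Real.log F))) ^ 2 / (2 * N)))) ≤ 2 * (N : ℝ) ^ (-(1 / 8) : ℝ) * (1 / 2) ^ k := by
  have hN0 : (0 : ℝ) < N := by
    exact_mod_cast (by omega : 0 < N)
  have hF0 : (0 : ℝ) < F := by
    exact_mod_cast (by omega : 0 < F)
  have hC0 : (0 : ℝ) < N.choose k := by
    exact_mod_cast Nat.choose_pos (by omega)
  set L := Real.log (N.choose k) + k * Real.log F with hL
  set X : ℝ := N.choose k * F ^ k with hX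
  have hX0 : 0 < X := by positivity
  have hLX : L = Real.log X := by
    rw [hX, Real.log_mul (by positivity) (by positivity), Real.log_pow]
  have hXlow : (N : ℝ) * 2 ^ k ≤ X := by
    have h1 : 6 ^ (k - 1) ≤ (N - 1).choose (k - 1) := pow_le_choose_of_mul_le (by omega)
    have h2 := choose_mul_self_eq (show 0 < N by omega) (show 0 < k by omega)
    have h3 : 2 ^ k ≤ 6 ^ (k - 1) := by
      obtain ⟨q, rfl⟩ := Nat.exists_eq_add_of_le hk
      rw [show 2 + q - 1 = 1 + q by omega, pow_add, pow_add]
      exact Nat.mul_le_mul (by norm_num) (Nat.pow_le_pow_left (by norm_num) _)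
    have h4 : k ≤ 2 ^ k := Nat.lt_two_pow_self.le
    have h5 : N * 2 ^ k ≤ N.choose k * 2 ^ k := by
      calc N * 2 ^ k ≤ N * (N - 1).choose (k - 1) := Nat.mul_le_mul_left _ (h3.trans h1)
        _ = N.choose k * k := h2.symm
        _ ≤ _ := Nat.mul_le_mul_left _ h4
    have h6 : N * 2 ^ k ≤ N.choose k * F ^ k :=
      h5.trans (Nat.mul_le_mul_left _ (Nat.pow_le_pow_left hF _))
    rw [hX]
    exact_mod_cast h6
  have hXge1 : 1 ≤ X := by
    refine le_trans ?_ hXlow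
    exact_mod_cast Nat.mul_pos (show 0 < N by omega) (by positivity)
  have hL0 : 0 ≤ L := hLX ▸ Real.log_nonneg hXge1
  have hup : ((N * F).choose k : ℝ) ≤ X ^ 2 := by
    have h1 : (N * F).choose k ≤ (2 * F) ^ k * N.choose k := by
      refine choose_le_pow_mul_choose fun i hi => ?_
      calc N * F - i ≤ N * F := Nat.sub_le _ _
        _ ≤ 2 * (N - i) * F := Nat.mul_le_mul_right _ (by omega)
        _ = _ := by ring
    have h2 : (2 * F) ^ k * N.choose k ≤ (N.choose k * F ^ k) ^ 2 := by
      calc _ ≤ (F * F) ^ k * N.choose k := by gcongr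
        _ = N.choose k * F ^ k * F ^ k := by rw [mul_pow]; ring
        _ ≤ N.choose k * F ^ k * F ^ k * N.choose k :=
          Nat.le_mul_of_pos_right _ (Nat.choose_pos (by omega))
        _ = _ := by ring
    rw [hX]
    exact_mod_cast h1.trans h2
  have hexp : Real.exp (-((5 / 2 * √(N * L)) ^ 2 / (2 * N))) = X ^ (-(25 / 8) : ℝ) := by
    rw [mul_pow, Real.sq_sqrt (by positivity), Real.rpow_def_of_pos hX0, ← hLX]
    congr 1
    field_simp
    ring
  rw [hexp]
  calc ((N * F).choose k : ℝ) * N * (2 * X ^ (-(25 / 8) : ℝ))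
      ≤ X ^ 2 * N * (2 * X ^ (-(25 / 8) : ℝ)) := by gcongr
    _ = 2 * N * X ^ (-(9 / 8) : ℝ) := by
        rw [show (-(9 / 8) : ℝ) = (2 : ℕ) + -(25 / 8) by norm_num, Real.rpow_add hX0,
          Real.rpow_natCast]
        ring
    _ ≤ 2 * N * ((N : ℝ) * 2 ^ k) ^ (-(9 / 8) : ℝ) := by
        gcongr 2 * (N : ℝ) * ?_
        exact Real.rpow_le_rpow_of_nonpos (by positivity) hXlow (by norm_num)
    _ = 2 * (N * (N : ℝ) ^ (-(9 / 8) : ℝ)) * ((2 : ℝ) ^ k) ^ (-(9 / 8) : ℝ) := by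
        rw [Real.mul_rpow (by positivity) (by positivity)]
        ring
    _ ≤ 2 * (N : ℝ) ^ (-(1 / 8) : ℝ) * (1 / 2) ^ k := by
        have h1 : (N : ℝ) * (N : ℝ) ^ (-(9 / 8) : ℝ) = (N : ℝ) ^ (-(1 / 8) : ℝ) := by
          rw [show (-(1 / 8) : ℝ) = 1 + -(9 / 8) by norm_num, Real.rpow_add hN0, Real.rpow_one]
        rw [h1]
        gcongr
        calc ((2 : ℝ) ^ k) ^ (-(9 / 8) : ℝ) ≤ ((2 : ℝ) ^ k) ^ (-1 : ℝ) :=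
              Real.rpow_le_rpow_of_exponent_le (one_le_pow₀ (by norm_num)) (by norm_num)
          _ = (1 / 2) ^ k := by rw [Real.rpow_neg_one, one_div, inv_pow]

lemma exists_nat_two_mul_gt (x B : ℝ) (hx : 0 ≤ x) (hB : x ≤ B) :
    ∃ j : ℕ, x < 2 * j ∧ (j : ℝ) ≤ x / 2 + 1 ∧ (j : ℝ) ≤ B / 2 + 1 := by
  refine ⟨⌊x / 2⌋₊ + 1, ?_, ?_, ?_⟩ <;> push_cast
  · linarith [Nat.lt_floor_add_one (x / 2)]
  · linarith [Nat.floor_le (show 0 ≤ x / 2 by positivity)]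
  · linarith [Nat.floor_le (show 0 ≤ x / 2 by positivity)]

lemma log_choose_le {N W r : ℕ} (hr : 0 < r) (hW : N ≤ 3 * W) (hrW : 2 * r ≤ W) (hrN : r < N) :
    Real.log (N.choose (r + 1)) ≤
      Real.log N + r * Real.log 5 + Real.log (W.choose r) := by
  have hCW : 0 < W.choose r := Nat.choose_pos (by omega)
  have hCN : 0 < N.choose (r + 1) := Nat.choose_pos (by omega)
  have h1 : (3 * W).choose r ≤ 5 ^ r * W.choose r :=
    choose_le_pow_mul_choose fun i hi => by omega
  have h2 := choose_mul_self_eq (show 0 < N by omega) (show 0 < r + 1 by omega)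
  have h3 : N.choose (r + 1) ≤ N * (5 ^ r * W.choose r) := by
    calc N.choose (r + 1) ≤ N.choose (r + 1) * (r + 1) := Nat.le_mul_of_pos_right _ (by omega)
      _ = N * (N - 1).choose r := h2
      _ ≤ _ := Nat.mul_le_mul_left _ ((Nat.choose_le_choose r (by omega)).trans h1)
  have hN : (0 : ℝ) < N := by exact_mod_cast (by omega : 0 < N)
  have hCW' : (0 : ℝ) < W.choose r := by exact_mod_cast hCW
  rw [← Real.log_pow, ← Real.log_mul (by positivity) (by positivity),
    ← Real.log_mul (by positivity) (by positivity), mul_assoc]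
  exact Real.log_le_log (by exact_mod_cast hCN) (by exact_mod_cast h3)

lemma le_log_choose {W r : ℕ} (hr : 0 < r) (hrW : 2 * r ≤ W) :
    Real.log W - Real.log r + (r - 1) * Real.log 2 ≤ Real.log (W.choose r) := by
  have h1 : 2 ^ (r - 1) ≤ (W - 1).choose (r - 1) := pow_le_choose_of_mul_le (by omega)
  have h2 := choose_mul_self_eq (show 0 < W by omega) hr
  have h3 : W * 2 ^ (r - 1) ≤ W.choose r * r := h2 ▸ Nat.mul_le_mul_left _ h1
  have hW0 : (0 : ℝ) < W := by exact_mod_cast (by omega : 0 < W)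
  have hr0 : (0 : ℝ) < r := by exact_mod_cast hr
  have hC0 : (0 : ℝ) < W.choose r := by exact_mod_cast Nat.choose_pos (by omega)
  have h4 : Real.log (W * 2 ^ (r - 1)) ≤ Real.log (W.choose r * r) :=
    Real.log_le_log (by positivity) (by exact_mod_cast h3)
  rw [Real.log_mul (by positivity) (by positivity), Real.log_mul (by positivity) (by positivity),
    Real.log_pow, Nat.cast_sub hr, Nat.cast_one] at h4
  linarith

lemma log_bound_of_entropy {l5 l2 l3 l lr a lW lG lF r : ℝ} (hr : 1 ≤ r)
    (hl2 : 0.6931 < l2) (hl2' : l2 < 0.6932) (hl5 : l5 ≤ 1.64) (hl3 : l3 ≤ 1.39)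
    (hlr : lr ≤ r / 16 + 1.78) (hlW : l - l3 ≤ lW) (ha : lW - lr + (r - 1) * l2 ≤ a)
    (hl : 0 ≤ l) (hlG : 0 ≤ lG) (hFG : lF ≤ l2 + lG) :
    l / 8 + r / 20 - 8 ≤
      r * lG + a - 0.18 * (l + r * l5 + a + (r + 1) * lF) - 2 - l2 - l / 2 := by
  have h1 : (r + 1) * lF ≤ (r + 1) * (l2 + lG) :=
    mul_le_mul_of_nonneg_left hFG (by linarith)
  have h2 : r * l5 ≤ r * 1.64 := mul_le_mul_of_nonneg_left hl5 (by linarith)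
  have h3 : 0 ≤ (r - 1) * lG := mul_nonneg (by linarith) hlG
  have h4 : r * 0.6931 ≤ r * l2 := mul_le_mul_of_nonneg_left hl2.le (by linarith)
  nlinarith

lemma exists_binomial_parameters {N G r : ℕ} (hN : 300 ≤ N) (hG : 1 ≤ G) (hr : 1 ≤ r)
    (hrN : 6 * (r + 1) ≤ N)
    (hF : ((r + 1 : ℕ) : ℝ) * Real.log (G + 1 : ℕ) ≤ N / 6 * Real.log 2) :
    ∃ j m W : ℕ, W + 2 * m ≤ N ∧ 0 < m ∧
      2 / 5 * √(N * (Real.log (N.choose (r + 1)) + (r + 1 : ℕ) * Real.log (G + 1 : ℕ))) < 2 * j ∧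
      1 ≤ Real.exp 8 * (N : ℝ) ^ (-(1 / 8) : ℝ) * Real.exp (-(r / 20)) *
        ((W * G).choose r * ((2 * m).choose (m + j) / 4 ^ m)) := by
  set L := Real.log (N.choose (r + 1)) + (r + 1 : ℕ) * Real.log (G + 1 : ℕ) with hL
  set lam := 2 / 5 * √(N * L) with hlam
  have hNr : (300 : ℝ) ≤ N := by exact_mod_cast hN
  have hCpos : 0 < N.choose (r + 1) := Nat.choose_pos (by omega)
  have hl2 := Real.log_two_gt_d9
  have hl2' := Real.log_two_lt_d9
  have hL0 : 0 ≤ L := add_nonneg (Real.log_natCast_nonneg _)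
    (mul_nonneg (Nat.cast_nonneg _) (Real.log_natCast_nonneg _))
  have hLN : L ≤ 0.809 * N := by
    have : Real.log (N.choose (r + 1)) ≤ N * Real.log 2 := by
      rw [← Real.log_pow]
      refine Real.log_le_log (by exact_mod_cast hCpos) ?_
      exact_mod_cast Nat.choose_le_two_pow N (r + 1)
    nlinarith
  have hlam0 : 0 ≤ lam := by positivity
  have hlamsq : lam ^ 2 = 0.16 * (N * L) := by
    rw [hlam, mul_pow, Real.sq_sqrt (by positivity)]
    norm_num
  have hlamN : lam ≤ 0.36 * N := by
    refine abs_le_of_sq_le_sq' ?_ (by positivity) |>.2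
    rw [hlamsq]
    nlinarith
  obtain ⟨j, hj, hj1, hj2⟩ := exists_nat_two_mul_gt lam (0.36 * N) hlam0 hlamN
  set m := N / 3 with hm
  set W := N - 2 * m with hW
  have hmpos : 0 < m := by omega
  have hmN : (N : ℝ) ≤ 3 * (m + 1) := by exact_mod_cast (by omega : N ≤ 3 * (m + 1))
  have hmN' : (m : ℝ) ≤ N := by exact_mod_cast (by omega : m ≤ N)
  have hm0 : (0 : ℝ) < m := by exact_mod_cast hmpos
  have hNW : N ≤ 3 * W := by omega
  have hrW : 2 * r ≤ W := by omega
  have hW0 : (0 : ℝ) < W := by exact_mod_cast (by omega : 0 < W)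
  have hr0 : (1 : ℝ) ≤ r := by exact_mod_cast hr
  refine ⟨j, m, W, by omega, hmpos, hj, ?_⟩
  have hjm : (j : ℝ) / (m + 1) ≤ 11 / 20 := by
    rw [div_le_iff₀ (by positivity)]
    nlinarith
  obtain ⟨hppos, hp⟩ := le_log_choose_div_four_pow hmpos hjm
  have hquad : 3 / 2 * ((j : ℝ) ^ 2 / (m + 1)) ≤ 0.18 * L + 2 := by
    rw [mul_div_assoc', div_le_iff₀ (by positivity)]
    have h1 : (j : ℝ) ^ 2 ≤ (lam / 2 + 1) ^ 2 := by gcongr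
    have h2 : (0.18 * L + 2) * (N / 3) ≤ (0.18 * L + 2) * (m + 1) := by
      gcongr
      linarith
    nlinarith
  have hlogm : Real.log m ≤ Real.log N := Real.log_le_log hm0 hmN'
  have hCWpos : (0 : ℝ) < W.choose r := by
    exact_mod_cast Nat.choose_pos (by omega)
  have hG0 : (1 : ℝ) ≤ G := by exact_mod_cast hG
  have hCWG : r * Real.log G + Real.log (W.choose r) ≤ Real.log ((W * G).choose r) := by
    rw [← Real.log_pow, ← Real.log_mul (by positivity) (by positivity)]
    refine Real.log_le_log (by positivity) ?_
    exact_mod_cast pow_mul_choose_le_choose_mul G W r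
  have hCWGpos : (0 : ℝ) < (W * G).choose r := by
    exact_mod_cast Nat.choose_pos (le_trans (by omega) (Nat.le_mul_of_pos_right W hG))
  have hent := log_bound_of_entropy (l5 := Real.log 5) (l2 := Real.log 2) (l3 := Real.log 3)
    (l := Real.log N) (lr := Real.log r) (a := Real.log (W.choose r)) (lW := Real.log W)
    (lG := Real.log G) (lF := Real.log (G + 1 : ℕ)) (r := r) hr0 (by linarith) (by linarith)
    (by
      have h := Real.log_le_sub_one_of_pos (show (0 : ℝ) < 5 / 4 by norm_num)
      rw [Real.log_div (by norm_num) (by norm_num), show (4 : ℝ) = 2 ^ 2 by norm_num,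
        Real.log_pow] at h
      norm_num at h ⊢
      linarith)
    (by
      have h := Real.log_le_log (by norm_num) (show (3 : ℝ) ≤ 2 ^ 2 by norm_num)
      rw [Real.log_pow] at h
      norm_num at h ⊢
      linarith)
    (by
      have h := Real.log_le_sub_one_of_pos (show (0 : ℝ) < r / 2 ^ 4 by positivity)
      rw [Real.log_div (by positivity) (by norm_num), Real.log_pow] at h
      norm_num at h ⊢
      linarith)
    (by
      rw [← Real.log_div (by positivity) (by norm_num)]
      refine Real.log_le_log (by positivity) ?_
      rw [div_le_iff₀ (by norm_num)]
      exact_mod_cast (by omega : N ≤ W * 3))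
    (le_log_choose (by omega) hrW) (Real.log_natCast_nonneg _) (Real.log_natCast_nonneg _)
    (by
      rw [← Real.log_mul (by norm_num) (by positivity)]
      refine Real.log_le_log (by positivity) ?_
      push_cast
      linarith)
  have hLle := log_choose_le (by omega) hNW hrW (show r < N by omega)
  have hlow : Real.log N / 8 + r / 20 - 8 ≤ Real.log ((W * G).choose r) +
      Real.log ((2 * m).choose (m + j) / 4 ^ m : ℝ) := by
    have hL' : L ≤ Real.log N + r * Real.log 5 + Real.log (W.choose r) +
        (r + 1) * Real.log (G + 1 : ℕ) := by
      rw [hL, Nat.cast_add r, Nat.cast_one]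
      linarith
    linarith
  rw [← Real.log_mul hCWGpos.ne' hppos.ne', Real.le_log_iff_exp_le (by positivity)] at hlow
  have hNpow : (N : ℝ) ^ (-(1 / 8) : ℝ) = Real.exp (-(Real.log N / 8)) := by
    rw [Real.rpow_def_of_pos (by positivity)]
    congr 1
    ring
  calc (1 : ℝ) = Real.exp 8 * (N : ℝ) ^ (-(1 / 8) : ℝ) * Real.exp (-(r / 20)) *
        Real.exp (Real.log N / 8 + r / 20 - 8) := by
        rw [hNpow, ← Real.exp_add, ← Real.exp_add, ← Real.exp_add, ← Real.exp_zero]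
        congr 1
        ring
    _ ≤ _ := by gcongr

open Classical in
lemma card_injective_not_between_le {N F k : ℕ} (hN : 300 ≤ N) (hF : 2 ≤ F) (hk : 2 ≤ k)
    (hkN : 6 * k ≤ N) (hkF : (k : ℝ) * Real.log F ≤ N / 6 * Real.log 2) :
    (#{ω : Fin F → Fin N → Bool | Function.Injective ω ∧
      ¬ ((2/5) * √((N : ℝ) * (Real.log (N.choose k) + k * Real.log F)) <
          (famCrossCorr k (Finset.univ.image ω) : ℝ) ∧
        (famCrossCorr k (Finset.univ.image ω) : ℝ) <
          (5/2) * √((N : ℝ) * (Real.log (N.choose k) + k * Real.log F)))} : ℝ) ≤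
      (N : ℝ) ^ (-(1 / 8) : ℝ) * ((2 + Real.exp 9) * Real.exp (-(1 / 20)) ^ k) *
        Fintype.card (Fin F → Fin N → Bool) := by
  set s := √((N : ℝ) * (Real.log (N.choose k) + k * Real.log F)) with hs
  set c : ℝ := (Fintype.card (Fin F → Fin N → Bool) : ℝ) with hc
  have hs0 : 0 < s := by
    have h1 : 0 < Real.log F := Real.log_pos (by exact_mod_cast hF)
    have h2 : 0 ≤ Real.log (N.choose k) := Real.log_natCast_nonneg _
    have h3 : (0 : ℝ) < N := by exact_mod_cast (by omega : 0 < N)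
    have h4 : (0 : ℝ) < k := by exact_mod_cast (by omega : 0 < k)
    rw [hs]
    positivity
  have hup := card_exists_le_corrSum (N := N) (F := F) (k := k) (by omega) (5 / 2 * s)
    (by positivity)
  have hup' := hup.trans (mul_le_mul_of_nonneg_right (choose_mul_exp_le hk hF hkN)
    (Nat.cast_nonneg _))
  obtain ⟨G, rfl⟩ : ∃ G, F = G + 1 := ⟨F - 1, by omega⟩
  obtain ⟨r, rfl⟩ : ∃ r, k = r + 1 := ⟨k - 1, by omega⟩
  obtain ⟨j, m, W, hW, hm, hj, hone⟩ :=
    exists_binomial_parameters hN (by omega : 1 ≤ G) (by omega : 1 ≤ r) hkN hkF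
  have hlo := card_forall_corrSum_ne_mul (N := N) (G := G) (r := r) j hW
  set P : ℝ := (W * G).choose r * ((2 * m).choose (m + j) / 4 ^ m) with hP
  set a : ℝ := Real.exp 8 * (N : ℝ) ^ (-(1 / 8) : ℝ) * Real.exp (-(r / 20)) with ha
  set U : Finset (Fin (G + 1) → Fin N → Bool) := {ω | ∃ (S : Finset (ℕ × Fin (G + 1))) (M : ℕ),
    #S = r + 1 ∧ 1 ≤ M ∧ (∀ p ∈ S, M + p.1 ≤ N) ∧ 5 / 2 * s ≤ ((corrSum ω S M).natAbs : ℝ)}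
  set V : Finset (Fin (G + 1) → Fin N → Bool) := {ω | ∀ S : Finset (ℕ × Fin (G + 1)),
    #S = r + 1 → (∀ p ∈ S, 2 * m + p.1 ≤ N) → corrSum ω S (2 * m) ≠ 2 * (j : ℤ)}
  have hV : (#V : ℝ) ≤ a * c := by
    calc (#V : ℝ) ≤ #V * (a * P) := le_mul_of_one_le_right (Nat.cast_nonneg _) hone
      _ = a * (#V * P) := by ring
      _ ≤ a * c := mul_le_mul_of_nonneg_left hlo (by positivity)
  have hsub : ({ω : Fin (G + 1) → Fin N → Bool | Function.Injective ω ∧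
      ¬ ((2/5) * s < (famCrossCorr (r + 1) (Finset.univ.image ω) : ℝ) ∧
        (famCrossCorr (r + 1) (Finset.univ.image ω) : ℝ) < (5/2) * s)} : Finset _) ⊆ U ∪ V := by
    intro ω hω
    obtain ⟨hinj, hbad⟩ := (Finset.mem_filter.1 hω).2
    rw [Finset.mem_union]
    have hbdd := bddAbove_famCorrSet (r + 1) (Finset.univ.image ω) (by omega)
    by_cases hlow : (2/5) * s < (famCrossCorr (r + 1) (Finset.univ.image ω) : ℝ)
    · left
      have hge : 5 / 2 * s ≤ (famCrossCorr (r + 1) (Finset.univ.image ω) : ℝ) :=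
        not_lt.1 fun h => hbad ⟨hlow, h⟩
      have hne : (famCorrSet (r + 1) (Finset.univ.image ω)).Nonempty := by
        by_contra hne
        rw [Set.not_nonempty_iff_eq_empty] at hne
        rw [famCrossCorr, hne, csSup_empty] at hge
        simp only [bot_eq_zero', Nat.cast_zero] at hge
        linarith
      obtain ⟨S, M, h1, h2, h3, h4⟩ := exists_corrSum_of_mem_famCorrSet (Nat.sSup_mem hne hbdd)
      exact (Finset.mem_filter_univ _).2 ⟨S, M, h1, h2, h3, h4 ▸ hge⟩
    · right
      refine (Finset.mem_filter_univ _).2 fun S hS hSN heq => hlow (hj.trans_le ?_)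
      have hmem := natAbs_corrSum_mem_famCorrSet hinj S (by omega : 1 ≤ 2 * m) hSN
      rw [hS, heq] at hmem
      have : 2 * j ≤ famCrossCorr (r + 1) (Finset.univ.image ω) :=
        (by omega : 2 * j = (2 * (j : ℤ)).natAbs).trans_le (le_csSup hbdd hmem)
      exact_mod_cast this
  have hhalf : (1 / 2 : ℝ) ^ (r + 1) ≤ Real.exp (-(1 / 20)) ^ (r + 1) := by
    gcongr
    linarith [Real.add_one_le_exp (-(1 / 20) : ℝ)]
  have hexp : Real.exp 8 * Real.exp (-(r / 20)) ≤ Real.exp 9 * Real.exp (-(1 / 20)) ^ (r + 1) := by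
    rw [← Real.exp_nat_mul, ← Real.exp_add, ← Real.exp_add]
    refine Real.exp_le_exp.2 ?_
    push_cast
    linarith
  calc _ ≤ ((#U + #V : ℕ) : ℝ) := by
        exact_mod_cast (Finset.card_le_card hsub).trans (Finset.card_union_le _ _)
    _ ≤ 2 * (N : ℝ) ^ (-(1 / 8) : ℝ) * (1 / 2) ^ (r + 1) * c + a * c := by
        push_cast
        exact add_le_add hup' hV
    _ = (N : ℝ) ^ (-(1 / 8) : ℝ) *
        (2 * (1 / 2) ^ (r + 1) + Real.exp 8 * Real.exp (-(r / 20))) * c := by rw [ha]; ring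
    _ ≤ _ := by
        gcongr
        rw [add_mul]
        gcongr

lemma card_filter_powersetCard_mul_factorial_le {X : Type*} [Fintype X] [DecidableEq X] (F : ℕ)
    (B : Finset X → Prop) [DecidablePred B] :
    #{A ∈ (Finset.univ : Finset X).powersetCard F | B A} * F.factorial ≤
      #{ω : Fin F → X | Function.Injective ω ∧ B (Finset.univ.image ω)} := by
  set T := {A ∈ (Finset.univ : Finset X).powersetCard F | B A} with hT
  have hcard : ∀ A ∈ T, #A = F := fun A hA =>
    (Finset.mem_powersetCard.1 (Finset.mem_filter.1 hA).1).2
  have henum : ∀ A : T, ∃ e : Fin F → X, Function.Injective e ∧ Finset.univ.image e = A.1 := by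
    rintro ⟨A, hA⟩
    let e := (A.equivFinOfCardEq (hcard A hA)).symm
    refine ⟨fun i => e i, Subtype.val_injective.comp e.injective, ?_⟩
    ext x
    simp only [Finset.mem_image, Finset.mem_univ, true_and]
    exact ⟨fun ⟨i, hi⟩ => hi ▸ (e i).2, fun hx => ⟨e.symm ⟨x, hx⟩, by simp⟩⟩
  choose e he himg using henum
  have himg' : ∀ (A : T) (π : Equiv.Perm (Fin F)), Finset.univ.image (e A ∘ π) = A.1 :=
    fun A π => by
      rw [← Finset.image_image, Finset.image_univ_of_surjective π.surjective, himg]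
  calc #T * F.factorial = #(Finset.univ : Finset (T × Equiv.Perm (Fin F))) := by
        simp [Fintype.card_perm]
    _ ≤ _ := by
      refine Finset.card_le_card_of_injOn (fun q => e q.1 ∘ q.2) ?_ ?_
      · rintro ⟨A, π⟩ -
        refine Finset.mem_coe.2 ((Finset.mem_filter_univ _).2 ⟨(he A).comp π.injective, ?_⟩)
        rw [himg']
        exact (Finset.mem_filter.1 A.2).2
      · rintro ⟨A, π⟩ - ⟨A', π'⟩ - h
        have hA : A = A' := Subtype.ext (by
          rw [← himg' A π, ← himg' A' π']
          exact congrArg (fun f => Finset.univ.image f) h)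
        subst hA
        refine Prod.ext rfl (Equiv.ext fun i => he A (congrFun h i))

lemma card_fun_le_two_mul_choose_mul_factorial {n F : ℕ} (h : 2 * F ^ 2 ≤ n) :
    n ^ F ≤ 2 * (n.choose F * F.factorial) := by
  rcases Nat.eq_zero_or_pos F with rfl | hF
  · simp
  have hn : (0 : ℝ) < n := by
    exact_mod_cast (by positivity : 0 < 2 * F ^ 2).trans_le h
  have hFn : F ≤ n := by nlinarith
  have h1 := Nat.pow_sub_le_descFactorial n F
  have h' : 2 * (F : ℝ) ^ 2 ≤ n := by exact_mod_cast h
  have h2 : (1 / 2 : ℝ) ≤ (1 + -(F / n)) ^ F := by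
    refine le_trans ?_ (one_add_mul_le_pow ?_ F)
    · have : (F : ℝ) * (F / n) ≤ 1 / 2 := by
        rw [← mul_div_assoc, div_le_iff₀ hn]
        linarith
      linarith
    · have : (F : ℝ) / n ≤ 1 := by
        rw [div_le_one hn]
        exact_mod_cast hFn
      linarith
  have h3 : ((n : ℝ) - F) ^ F ≤ n.descFactorial F := by
    have h4 : ((n : ℝ) - F) ≤ (n + 1 - F : ℕ) := by
      rw [Nat.cast_sub (by omega)]
      push_cast
      linarith
    calc ((n : ℝ) - F) ^ F ≤ ((n + 1 - F : ℕ) : ℝ) ^ F := by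
          gcongr
          rw [sub_nonneg]
          exact_mod_cast hFn
      _ ≤ _ := by exact_mod_cast h1
  have h5 : (n : ℝ) ^ F ≤ 2 * n.descFactorial F := by
    calc (n : ℝ) ^ F = 2 * (n ^ F * (1 / 2)) := by ring
      _ ≤ 2 * (n ^ F * (1 + -(F / n)) ^ F) := by gcongr
      _ = 2 * ((n : ℝ) - F) ^ F := by
          rw [← mul_pow]
          congr 2
          field_simp
          ring
      _ ≤ _ := by gcongr
  rw [mul_comm (n.choose F), ← Nat.descFactorial_eq_factorial_mul_choose]
  exact_mod_cast h5

/-- For every `ε > 0` there is `N₀` such that for `N > N₀` and every family size `Fsize`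
with `1 ≤ log₂ Fsize < N/12`, a uniformly random family `𝓕 ⊆ {-1,1}^N` of cardinality
`Fsize` satisfies, with probability at least `1 - ε`,
`(2/5)·√(N(log C(N,k) + k log Fsize)) < Φₖ(𝓕) < (5/2)·√(N(log C(N,k) + k log Fsize))`
for every `k` with `2 ≤ k ≤ N/(6 log₂ Fsize)`. -/
theorem typical_cross_correlation_family :
    ∀ ε : ℝ, 0 < ε → ∃ N₀ : ℕ, ∀ N : ℕ, N₀ < N →
    ∀ Fsize : ℕ, 1 ≤ Real.logb 2 Fsize → Real.logb 2 Fsize < (N : ℝ) / 12 →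
    (1 - ε) * ({F : Finset (Fin N → Bool) | F.card = Fsize}.ncard : ℝ) ≤
      ({F : Finset (Fin N → Bool) | F.card = Fsize ∧
        ∀ k : ℕ, 2 ≤ k → (k : ℝ) ≤ (N : ℝ) / (6 * Real.logb 2 Fsize) →
          (2/5) * Real.sqrt ((N : ℝ) *
              (Real.log (N.choose k) + k * Real.log Fsize)) < (famCrossCorr k F : ℝ) ∧
          (famCrossCorr k F : ℝ) < (5/2) * Real.sqrt ((N : ℝ) *
              (Real.log (N.choose k) + k * Real.log Fsize))}.ncard : ℝ) := by
  classical
  intro ε hε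
  set q : ℝ := Real.exp (-(1 / 20)) with hq
  have hq0 : 0 < q := Real.exp_pos _
  have hq1 : q < 1 := (Real.exp_lt_exp.2 (by norm_num)).trans_eq Real.exp_zero
  set K : ℝ := 2 * ((2 + Real.exp 9) * (1 - q)⁻¹) with hK
  have hlim : Filter.Tendsto (fun N : ℕ => (N : ℝ) ^ (-(1 / 8) : ℝ) * K) Filter.atTop
      (nhds 0) := by
    have := ((tendsto_rpow_neg_atTop (show (0 : ℝ) < 1 / 8 by norm_num)).comp
      tendsto_natCast_atTop_atTop).mul_const K
    simpa using this
  obtain ⟨N₁, hN₁⟩ := Filter.eventually_atTop.1 (hlim.eventually_le_const hε)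
  refine ⟨max N₁ 300, fun N hN F hF1 hF2 => ?_⟩
  have hN300 : 300 ≤ N := ((le_max_right _ _).trans_lt hN).le
  have hKN : (N : ℝ) ^ (-(1 / 8) : ℝ) * K ≤ ε := hN₁ N ((le_max_left _ _).trans_lt hN).le
  have hl2 : 0 < Real.log 2 := Real.log_pos one_lt_two
  have hFpos : 0 < F := Nat.pos_of_ne_zero fun h => by
    rw [h] at hF1
    norm_num at hF1
  have hFpos' : (0 : ℝ) < F := by exact_mod_cast hFpos
  have hF : 2 ≤ F := by
    rw [Real.le_logb_iff_rpow_le one_lt_two hFpos', Real.rpow_one] at hF1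
    exact_mod_cast hF1
  have hlogF : Real.logb 2 F * Real.log 2 = Real.log F := div_mul_cancel₀ _ hl2.ne'
  have hFpow : F ^ 12 ≤ 2 ^ N := by
    have : Real.log ((F : ℝ) ^ 12) ≤ Real.log (2 ^ N) := by
      rw [Real.log_pow, Real.log_pow, ← hlogF, ← mul_assoc]
      gcongr
      push_cast
      linarith
    rw [Real.log_le_log_iff (by positivity) (by positivity)] at this
    exact_mod_cast this
  have hFsq : 2 * F ^ 2 ≤ 2 ^ N := by
    calc 2 * F ^ 2 ≤ F * F ^ 2 := Nat.mul_le_mul_right _ hF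
      _ = F ^ 3 := by ring
      _ ≤ F ^ 12 := Nat.pow_le_pow_right hFpos (by norm_num)
      _ ≤ _ := hFpow
  let Good : ℕ → Finset (Fin N → Bool) → Prop := fun k A =>
    (2/5) * √((N : ℝ) * (Real.log (N.choose k) + k * Real.log F)) < (famCrossCorr k A : ℝ) ∧
      (famCrossCorr k A : ℝ) < (5/2) * √((N : ℝ) * (Real.log (N.choose k) + k * Real.log F))
  let Adm : ℕ → Prop := fun k => 2 ≤ k ∧ (k : ℝ) ≤ (N : ℝ) / (6 * Real.logb 2 F)
  have hAdm : ∀ k, Adm k → 6 * k ≤ N ∧ (k : ℝ) * Real.log F ≤ N / 6 * Real.log 2 := by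
    rintro k ⟨-, hk⟩
    rw [le_div_iff₀ (by positivity)] at hk
    constructor
    · have : (6 : ℝ) * k ≤ N := by nlinarith [Nat.cast_nonneg (α := ℝ) k]
      exact_mod_cast this
    · rw [← hlogF]
      nlinarith
  set Tot := (Finset.univ : Finset (Fin N → Bool)).powersetCard F with hTot
  let Bad : Finset (Fin N → Bool) → Prop := fun A => ∃ k, Adm k ∧ ¬ Good k A
  have hall : {A : Finset (Fin N → Bool) | A.card = F}.ncard = #Tot := by
    rw [← Set.ncard_coe_finset]
    congr 1
    ext A
    simp [hTot, Finset.mem_powersetCard]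
  have hgood : {A : Finset (Fin N → Bool) | A.card = F ∧ ∀ k : ℕ, 2 ≤ k →
      (k : ℝ) ≤ (N : ℝ) / (6 * Real.logb 2 F) → Good k A}.ncard =
      #{A ∈ Tot | ¬ Bad A} := by
    rw [← Set.ncard_coe_finset]
    congr 1
    ext A
    simp [hTot, Finset.mem_powersetCard, Bad, Adm]
  have hsplit := Finset.card_filter_add_card_filter_not (s := Tot) Bad
  set c : ℝ := (Fintype.card (Fin F → Fin N → Bool) : ℝ) with hc
  have hω : (#{ω : Fin F → Fin N → Bool | Function.Injective ω ∧
      Bad (Finset.univ.image ω)} : ℝ) ≤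
      (N : ℝ) ^ (-(1 / 8) : ℝ) * ((2 + Real.exp 9) * (1 - q)⁻¹) * c := by
    have hsub : ({ω : Fin F → Fin N → Bool | Function.Injective ω ∧
        Bad (Finset.univ.image ω)} : Finset _) ⊆
        {k ∈ Finset.range (N + 1) | Adm k}.biUnion fun k =>
          {ω | Function.Injective ω ∧ ¬ Good k (Finset.univ.image ω)} := by
      intro ω hω
      obtain ⟨hinj, k, hk, hbad⟩ := (Finset.mem_filter.1 hω).2
      refine Finset.mem_biUnion.2 ⟨k, Finset.mem_filter.2 ⟨?_, hk⟩,
        (Finset.mem_filter_univ _).2 ⟨hinj, hbad⟩⟩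
      have := (hAdm k hk).1
      exact Finset.mem_range.2 (by omega)
    calc _ ≤ ((∑ k ∈ Finset.range (N + 1) with Adm k, #{ω : Fin F → Fin N → Bool |
          Function.Injective ω ∧ ¬ Good k (Finset.univ.image ω)} : ℕ) : ℝ) := by
          exact_mod_cast (Finset.card_le_card hsub).trans Finset.card_biUnion_le
      _ ≤ ∑ k ∈ Finset.range (N + 1) with Adm k,
          (N : ℝ) ^ (-(1 / 8) : ℝ) * ((2 + Real.exp 9) * q ^ k) * c := by
          push_cast
          refine Finset.sum_le_sum fun k hk => ?_
          have hk := (Finset.mem_filter.1 hk).2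
          exact card_injective_not_between_le hN300 hF hk.1 (hAdm k hk).1 (hAdm k hk).2
      _ = (N : ℝ) ^ (-(1 / 8) : ℝ) *
          ((2 + Real.exp 9) * ∑ k ∈ Finset.range (N + 1) with Adm k, q ^ k) * c := by
          rw [Finset.mul_sum, Finset.mul_sum, Finset.sum_mul]
      _ ≤ _ := by
          gcongr
          rw [← tsum_geometric_of_lt_one hq0.le hq1]
          exact (summable_geometric_of_lt_one hq0.le hq1).sum_le_tsum _ fun _ _ => by positivity
  have hbadle : (#{A ∈ Tot | Bad A} : ℝ) ≤ ε * #Tot := by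
    have h1 : (#{A ∈ Tot | Bad A} : ℝ) * F.factorial ≤ _ :=
      le_trans (by exact_mod_cast card_filter_powersetCard_mul_factorial_le F Bad) hω
    have h2 : c ≤ 2 * (#Tot * F.factorial) := by
      have := card_fun_le_two_mul_choose_mul_factorial hFsq
      rw [hc, hTot, Finset.card_powersetCard]
      simp only [Fintype.card_pi, Fintype.card_bool, Finset.prod_const, Finset.card_univ,
        Fintype.card_fin]
      exact_mod_cast this
    have hfac : (0 : ℝ) < F.factorial := by exact_mod_cast F.factorial_pos
    have h1q : 0 < 1 - q := by linarith
    refine le_of_mul_le_mul_right (h1.trans ?_) hfac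
    calc _ ≤ (N : ℝ) ^ (-(1 / 8) : ℝ) * ((2 + Real.exp 9) * (1 - q)⁻¹) *
          (2 * (#Tot * F.factorial)) := by gcongr
      _ = (N : ℝ) ^ (-(1 / 8) : ℝ) * K * (#Tot * F.factorial) := by rw [hK]; ring
      _ ≤ ε * (#Tot * F.factorial) := by gcongr
      _ = _ := by ring
  rw [hall]
  refine le_of_le_of_eq ?_ (congrArg (Nat.cast (R := ℝ)) hgood.symm)
  have : (#{A ∈ Tot | Bad A} : ℝ) + #{A ∈ Tot | ¬ Bad A} = #Tot := by exact_mod_cast hsplit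
  linarith
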